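/- arXiv:2109.09123 — 2 statements merged into one kernel-verified Lean document; each statement's English description precedes it below -/
import Mathlib

section
/- Let T be an accretive operator on a complex Hilbert space H with closed range such that T² is m-accretive, and let S be a bounded accretive operator on H. Assume either (R(S) ⊆ R(T) and ‖(T†)² S‖ < 1) or (N(T) ⊆ N(S) and ‖S (T²)†‖ < 1). Then: R(T² + S) = R(T²) = R(T) is closed and N(T² + S) = N(T²) = N(T); H = R(T² + S) ⊕ N(T² + S); T² + S is an EP operator with (T² + S)† = (I + (T†)² S)⁻¹ (T†)² = (T†)² (I + S (T†)²)⁻¹. If moreover T is injective, then T, T² and T² + S are invertible and (T² + S)⁻¹ = (I + T⁻² S)⁻¹ T⁻² = T⁻² (I + S T⁻²)⁻¹. -/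
open scoped ComplexInnerProductSpace
noncomputable section

variable {H : Type*} [NormedAddCommGroup H] [InnerProductSpace ℂ H] [CompleteSpace H]

/-- The range of a partially defined operator, as a submodule of `H`. -/
def pRange (T : H →ₗ.[ℂ] H) : Submodule ℂ H := LinearMap.range T.toFun

/-- The kernel of a partially defined operator, as a submodule of `H`. -/
def pKer (T : H →ₗ.[ℂ] H) : Submodule ℂ H := (LinearMap.ker T.toFun).map T.domain.subtype

/-- An operator `T` is accretive if `Re ⟨T x, x⟩ ≥ 0` for all `x` in its domain. -/
def PAccretive (T : H →ₗ.[ℂ] H) : Prop := ∀ x : T.domain, 0 ≤ (⟪(x : H), T x⟫).re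

/-- `T` is m-accretive: accretive, densely defined, closed, and `R(μ + T) = H` for all `μ > 0`. -/
def MAccretive (T : H →ₗ.[ℂ] H) : Prop :=
  PAccretive T ∧ Dense (T.domain : Set H) ∧ IsClosed (T.graph : Set (H × H)) ∧
    ∀ μ : ℝ, 0 < μ → ∀ y : H, ∃ x : T.domain, (μ : ℂ) • (x : H) + T x = y

/-- `T` is sectorial with vertex `0` and semiangle `ω` (ω-accretive):
`W(T) ⊆ {z : |arg z| ≤ ω}`. -/
def SectorialP (T : H →ₗ.[ℂ] H) (ω : ℝ) : Prop :=
  ∀ x : T.domain, ‖(x : H)‖ = 1 → |(⟪(x : H), T x⟫).arg| ≤ ω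

/-- `y` is the orthogonal projection of `x` onto the closure of `M`. -/
def IsProjOnto (M : Submodule ℂ H) (x y : H) : Prop :=
  y ∈ M.topologicalClosure ∧ x - y ∈ Mᗮ

/-- `Td` is the Moore-Penrose inverse of `T`: a closed densely defined operator with
domain `R(T) ⊕ R(T)ᗮ` such that `T Td T = T` on `D(T)`, `Td T Td = Td` on `D(Td)`,
`T Td = P_{cl R(T)}` on `D(Td)` and `Td T = P_{N(T)ᗮ}` on `D(T)`. -/
structure IsMoorePenroseInverse (T Td : H →ₗ.[ℂ] H) : Prop where
  closed' : IsClosed (Td.graph : Set (H × H))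
  dense' : Dense (Td.domain : Set H)
  domain_eq : Td.domain = pRange T ⊔ (pRange T)ᗮ
  tdt : ∀ x : T.domain, ∃ (h1 : T x ∈ Td.domain) (h2 : Td ⟨T x, h1⟩ ∈ T.domain),
    T ⟨Td ⟨T x, h1⟩, h2⟩ = T x
  dtd : ∀ x : Td.domain, ∃ (h1 : Td x ∈ T.domain) (h2 : T ⟨Td x, h1⟩ ∈ Td.domain),
    Td ⟨T ⟨Td x, h1⟩, h2⟩ = Td x
  proj_range : ∀ x : Td.domain, ∃ h1 : Td x ∈ T.domain,
    IsProjOnto (pRange T) (x : H) (T ⟨Td x, h1⟩)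
  proj_ker : ∀ x : T.domain, ∃ h1 : T x ∈ Td.domain,
    IsProjOnto ((pKer T)ᗮ) (x : H) (Td ⟨T x, h1⟩)

/-- A bounded everywhere-defined operator viewed as a partially defined operator. -/
def clmToPMap (S : H →L[ℂ] H) : H →ₗ.[ℂ] H := S.toLinearMap.toPMap ⊤

/-- A partially defined operator is bounded if it is bounded on its domain. -/
def BoundedPMap (T : H →ₗ.[ℂ] H) : Prop := ∃ C : ℝ, ∀ x : T.domain, ‖T x‖ ≤ C * ‖(x : H)‖

/-- `T Td = Td T` on `D(T)`. -/
def CommutesOnDomain (T Td : H →ₗ.[ℂ] H) : Prop :=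
  ∀ x : T.domain, ∃ (h1 : (x : H) ∈ Td.domain) (h2 : Td ⟨(x : H), h1⟩ ∈ T.domain)
    (h3 : T x ∈ Td.domain), T ⟨Td ⟨(x : H), h1⟩, h2⟩ = Td ⟨T x, h3⟩

/-- `T` is an EP operator: its Moore-Penrose inverse is bounded and `T T† = T† T` on `D(T)`. -/
def IsEPPMap (T : H →ₗ.[ℂ] H) : Prop :=
  ∃ Td : H →ₗ.[ℂ] H, IsMoorePenroseInverse T Td ∧ BoundedPMap Td ∧ CommutesOnDomain T Td

/-- The sum `T + S` of a partially defined operator and a bounded operator, with domain `D(T)`. -/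
def addB (T : H →ₗ.[ℂ] H) (S : H →L[ℂ] H) : H →ₗ.[ℂ] H :=
  ⟨T.domain, T.toFun + S.toLinearMap.comp T.domain.subtype⟩

/-- The sum of two partially defined operators, with domain `D(A) ∩ D(B)`. -/
def pAdd (A B : H →ₗ.[ℂ] H) : H →ₗ.[ℂ] H :=
  ⟨A.domain ⊓ B.domain,
    A.toFun.comp (Submodule.inclusion inf_le_left) +
      B.toFun.comp (Submodule.inclusion inf_le_right)⟩

/-- The difference of two partially defined operators, with domain `D(A) ∩ D(B)`. -/
def pSub (A B : H →ₗ.[ℂ] H) : H →ₗ.[ℂ] H :=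
  ⟨A.domain ⊓ B.domain,
    A.toFun.comp (Submodule.inclusion inf_le_left) -
      B.toFun.comp (Submodule.inclusion inf_le_right)⟩

/-- The operator `-A - r` on `D(A)`. -/
def negShift (A : H →ₗ.[ℂ] H) (r : ℝ) : H →ₗ.[ℂ] H :=
  ⟨A.domain, -A.toFun - (r : ℂ) • A.domain.subtype⟩

/-- The composition `B ∘ A` of a bounded operator with a partially defined one. -/
def compB (B : H →L[ℂ] H) (A : H →ₗ.[ℂ] H) : H →ₗ.[ℂ] H :=
  ⟨A.domain, B.toLinearMap.comp A.toFun⟩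

/-- `T2` is the square `T ∘ T` of `T`, with domain `{x ∈ D(T) : T x ∈ D(T)}`. -/
def IsSquareOf (T T2 : H →ₗ.[ℂ] H) : Prop :=
  (∀ x : T2.domain, ∃ (h1 : (x : H) ∈ T.domain) (h2 : T ⟨(x : H), h1⟩ ∈ T.domain),
      T2 x = T ⟨T ⟨(x : H), h1⟩, h2⟩) ∧
  ∀ x : H, x ∈ T2.domain ↔ ∃ h : x ∈ T.domain, T ⟨x, h⟩ ∈ T.domain

/-- The reduced minimum modulus `γ(T) = inf {‖T x‖ : x ∈ N(T)ᗮ ∩ D(T), ‖x‖ = 1}`. -/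
def gammaP (T : H →ₗ.[ℂ] H) : ℝ :=
  sInf {r | ∃ x : T.domain, (x : H) ∈ (pKer T)ᗮ ∧ ‖(x : H)‖ = 1 ∧ r = ‖T x‖}

/-- The spectrum of a partially defined operator: the complement of the set of `μ` for which
`μ - A` has an everywhere-defined bounded inverse. -/
def pSpectrum (A : H →ₗ.[ℂ] H) : Set ℂ :=
  {μ | ¬ ∃ B : H →L[ℂ] H, (∀ x : A.domain, B (μ • (x : H) - A x) = (x : H)) ∧
        ∀ y : H, ∃ h : B y ∈ A.domain, μ • B y - A ⟨B y, h⟩ = y}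

/-- The numerical radius of a partially defined operator. -/
def pNumRad (A : H →ₗ.[ℂ] H) : ℝ :=
  sSup {r | ∃ x : A.domain, ‖(x : H)‖ = 1 ∧ r = ‖⟪(x : H), A x⟫‖}

/-- `B` is an everywhere-defined bounded inverse of the partially defined operator `A`. -/
def IsBoundedInverseOf (A : H →ₗ.[ℂ] H) (B : H →L[ℂ] H) : Prop :=
  (∀ x : A.domain, B (A x) = (x : H)) ∧ ∀ y : H, ∃ h : B y ∈ A.domain, A ⟨B y, h⟩ = y

/-- The real part `(T + T*)/2` of a bounded operator. -/
def reOp (T : H →L[ℂ] H) : H →L[ℂ] H := (2 : ℂ)⁻¹ • (T + ContinuousLinearMap.adjoint T)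

/-- The imaginary part `(T - T*)/(2i)` of a bounded operator. -/
def imOp (T : H →L[ℂ] H) : H →L[ℂ] H :=
  (2 * Complex.I)⁻¹ • (T - ContinuousLinearMap.adjoint T)

/-- A bounded operator is accretive if `Re ⟨T x, x⟩ ≥ 0` for all `x`. -/
def CAccretive (T : H →L[ℂ] H) : Prop := ∀ x : H, 0 ≤ (⟪x, T x⟫).re

/-- A bounded operator is sectorial with vertex `0` and semiangle `ω` if
`W(T) ⊆ {z : |arg z| ≤ ω}`. -/
def Sectorial (T : H →L[ℂ] H) (ω : ℝ) : Prop :=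
  ∀ x : H, ‖x‖ = 1 → |(⟪x, T x⟫).arg| ≤ ω

/-- The numerical radius `w(T) = sup {|⟨T x, x⟩| : ‖x‖ = 1}` of a bounded operator. -/
def numRad (T : H →L[ℂ] H) : ℝ := sSup {r | ∃ x : H, ‖x‖ = 1 ∧ r = ‖⟪x, T x⟫‖}

omit [CompleteSpace H] in
theorem mem_pRange_iff {A : H →ₗ.[ℂ] H} {y : H} : y ∈ pRange A ↔ ∃ x, (x, y) ∈ A.graph := by
  constructor
  · rintro ⟨x, rfl⟩
    exact ⟨x, A.mem_graph x⟩
  · rintro ⟨x, hx⟩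
    obtain ⟨z, -, hz⟩ := A.mem_graph_iff.1 hx
    exact ⟨z, hz⟩

omit [CompleteSpace H] in
theorem mem_pKer_iff {A : H →ₗ.[ℂ] H} {x : H} : x ∈ pKer A ↔ (x, 0) ∈ A.graph := by
  constructor
  · rintro ⟨z, hz, rfl⟩
    have := A.mem_graph z
    rwa [show A z = 0 from hz] at this
  · intro hx
    obtain ⟨z, rfl, hz⟩ := A.mem_graph_iff.1 hx
    exact ⟨z, hz, rfl⟩

omit [CompleteSpace H] in
theorem PAccretive.re_inner_nonneg {A : H →ₗ.[ℂ] H} (hA : PAccretive A) {x y : H}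
    (h : (x, y) ∈ A.graph) : 0 ≤ (⟪x, y⟫).re := by
  obtain ⟨z, hz, hy⟩ := A.mem_graph_iff.1 h
  simp only at hz hy
  rw [← hz, ← hy]
  exact hA z

omit [CompleteSpace H] in
/-- The kernel of an accretive operator is orthogonal to its range. -/
theorem PAccretive.pKer_le_orthogonal_pRange {A : H →ₗ.[ℂ] H} (hA : PAccretive A) :
    pKer A ≤ (pRange A)ᗮ := by
  intro x hx
  rw [Submodule.mem_orthogonal']
  intro v hv
  obtain ⟨y, hy⟩ := mem_pRange_iff.1 hv
  have key : ∀ t : ℝ, 0 ≤ (⟪y, v⟫).re - t * ‖⟪x, v⟫‖ ^ 2 := by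
    intro t
    have hmem := A.graph.sub_mem hy (A.graph.smul_mem ((t : ℂ) * ⟪x, v⟫) (mem_pKer_iff.1 hx))
    have h := hA.re_inner_nonneg (by simpa using hmem)
    rw [inner_sub_left, inner_smul_left, Complex.sub_re, map_mul, Complex.conj_ofReal,
      mul_assoc, Complex.conj_mul'] at h
    rw [← Complex.ofReal_pow, ← Complex.ofReal_mul, Complex.ofReal_re] at h
    exact h
  by_contra hne
  have hpos : 0 < ‖⟪x, v⟫‖ ^ 2 := by positivity
  have h := key (((⟪y, v⟫).re + 1) / ‖⟪x, v⟫‖ ^ 2)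
  rw [div_mul_cancel₀ _ hpos.ne'] at h
  linarith

omit [CompleteSpace H] in
/-- For an m-accretive operator the kernel is the orthogonal complement of the range. -/
theorem MAccretive.pKer_eq_orthogonal_pRange {A : H →ₗ.[ℂ] H} (hA : MAccretive A) :
    pKer A = (pRange A)ᗮ := by
  refine le_antisymm hA.1.pKer_le_orthogonal_pRange fun x hx => ?_
  obtain ⟨u, hu⟩ := hA.2.2.2 1 one_pos x
  simp only [Complex.ofReal_one, one_smul] at hu
  have h0 : ⟪A u, x⟫ = 0 := (Submodule.mem_orthogonal _ _).1 hx _ ⟨u, rfl⟩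
  rw [← hu, inner_add_right, inner_self_eq_norm_sq_to_K] at h0
  have h1 := congrArg Complex.re h0
  have h2 := hA.1 u
  rw [← Complex.conj_re, inner_conj_symm] at h2
  have h3 : 0 ≤ ‖A u‖ ^ 2 := by positivity
  have h4 : ‖A u‖ ^ 2 = 0 := by
    simp only [Complex.add_re, Complex.zero_re, Complex.coe_algebraMap, ← Complex.ofReal_pow,
      Complex.ofReal_re] at h1
    linarith
  have h5 : A u = 0 := by simpa using h4
  rw [h5, add_zero] at hu
  rw [mem_pKer_iff, ← hu, ← h5]
  exact A.mem_graph u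

theorem IsProjOnto.starProjection_eq {M : Submodule ℂ H} [M.HasOrthogonalProjection] {x y : H}
    (h : IsProjOnto M x y) : M.starProjection x = y := by
  refine Submodule.eq_starProjection_of_mem_orthogonal ?_ h.2
  rw [← Submodule.orthogonal_orthogonal M, Submodule.orthogonal_orthogonal_eq_closure]
  exact h.1

omit [CompleteSpace H] in
theorem isProjOnto_starProjection (M : Submodule ℂ H) [M.HasOrthogonalProjection] (x : H) :
    IsProjOnto M x (M.starProjection x) :=
  ⟨M.le_topologicalClosure (M.starProjection_apply_mem x), M.sub_starProjection_mem_orthogonal x⟩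

theorem IsMoorePenroseInverse.apply_mem_graph {A : H →ₗ.[ℂ] H} {B : H →L[ℂ] H}
    {R : Submodule ℂ H} [R.HasOrthogonalProjection] (hR : pRange A = R)
    (h : IsMoorePenroseInverse A (clmToPMap B)) (x : H) :
    (B x, R.starProjection x) ∈ A.graph := by
  subst hR
  obtain ⟨h1, h2⟩ := h.proj_range ⟨x, trivial⟩
  rw [h2.starProjection_eq]
  exact A.mem_graph ⟨B x, h1⟩

theorem IsMoorePenroseInverse.apply_of_mem_graph {A : H →ₗ.[ℂ] H} {B : H →L[ℂ] H}
    {R : Submodule ℂ H} [R.HasOrthogonalProjection] (hK : pKer A = Rᗮ)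
    (h : IsMoorePenroseInverse A (clmToPMap B)) {x y : H} (hxy : (x, y) ∈ A.graph) :
    B y = R.starProjection x := by
  obtain ⟨z, hz, hy⟩ := A.mem_graph_iff.1 hxy
  simp only at hz hy
  obtain ⟨h1, h2⟩ := h.proj_ker z
  rw [hK, Submodule.orthogonal_orthogonal] at h2
  rw [← hz, ← hy, h2.starProjection_eq]
  rfl

theorem IsMoorePenroseInverse.starProjection_apply {A : H →ₗ.[ℂ] H} {B : H →L[ℂ] H}
    {R : Submodule ℂ H} [R.HasOrthogonalProjection] (hK : pKer A = Rᗮ)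
    (h : IsMoorePenroseInverse A (clmToPMap B)) (x : H) :
    R.starProjection (B x) = B x := by
  obtain ⟨h1, h2, h3⟩ := h.dtd ⟨x, trivial⟩
  exact (h.apply_of_mem_graph hK (A.mem_graph ⟨B x, h1⟩)).symm.trans h3

omit [CompleteSpace H] in
/-- If the kernel and the range of `A` are orthogonal complements of each other, a bounded `B`
with values in the range and inverting `A` up to the projection is the Moore-Penrose inverse. -/
theorem isMoorePenroseInverse_clmToPMap {A : H →ₗ.[ℂ] H} {B : H →L[ℂ] H}
    {R : Submodule ℂ H} [R.HasOrthogonalProjection] (hR : pRange A = R) (hK : pKer A = Rᗮ)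
    (hAB : ∀ x, (B x, R.starProjection x) ∈ A.graph)
    (hBA : ∀ x y, (x, y) ∈ A.graph → B y = R.starProjection x)
    (hB : ∀ x, R.starProjection (B x) = B x) :
    IsMoorePenroseInverse A (clmToPMap B) := by
  have hdom : ∀ x, B x ∈ A.domain := fun x => A.mem_domain_iff.2 ⟨_, hAB x⟩
  have hval : ∀ x, A ⟨B x, hdom x⟩ = R.starProjection x := fun x =>
    ((A.image_iff (hdom x)).2 (hAB x)).symm
  have hBA' : ∀ x : A.domain, B (A x) = R.starProjection x := fun x => hBA _ _ (A.mem_graph x)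
  have hRA : ∀ x : A.domain, R.starProjection (A x) = A x := fun x =>
    Submodule.starProjection_eq_self_iff.2 (hR ▸ ⟨x, rfl⟩)
  refine ⟨?_, ?_, ?_, fun x => ⟨trivial, hdom _, ?_⟩, fun x => ⟨hdom _, trivial, ?_⟩,
    fun x => ⟨hdom _, ?_⟩, fun x => ⟨trivial, ?_⟩⟩
  · have : ((clmToPMap B).graph : Set (H × H)) = {p | B p.1 = p.2} := by
      ext ⟨x, y⟩
      simp only [SetLike.mem_coe, LinearPMap.mem_graph_iff, Set.mem_ofPred_eq]
      constructor
      · rintro ⟨z, rfl, hz⟩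
        exact hz
      · exact fun h => ⟨⟨x, trivial⟩, rfl, h⟩
    rw [this]
    exact isClosed_eq (by fun_prop) (by fun_prop)
  · exact dense_univ
  · rw [hR, Submodule.sup_orthogonal_of_hasOrthogonalProjection]
    rfl
  · exact (hval _).trans (hRA x)
  · exact (hBA' ⟨B x, hdom x⟩).trans (hB x)
  · rw [hR]
    exact (hval x).symm ▸ isProjOnto_starProjection R x
  · rw [hK, Submodule.orthogonal_orthogonal]
    change IsProjOnto R x (B (A x))
    exact (hBA' x).symm ▸ isProjOnto_starProjection R x

omit [CompleteSpace H] in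
theorem isEPPMap_of_apply {A : H →ₗ.[ℂ] H} {B : H →L[ℂ] H}
    {R : Submodule ℂ H} [R.HasOrthogonalProjection]
    (hMP : IsMoorePenroseInverse A (clmToPMap B))
    (hAB : ∀ x, (B x, R.starProjection x) ∈ A.graph)
    (hBA : ∀ x y, (x, y) ∈ A.graph → B y = R.starProjection x) : IsEPPMap A := by
  refine ⟨clmToPMap B, hMP, ⟨‖B‖, fun x => B.le_opNorm x⟩, fun x => ?_⟩
  have hdom : B x ∈ A.domain := A.mem_domain_iff.2 ⟨_, hAB x⟩
  exact ⟨trivial, hdom, trivial, ((A.image_iff hdom).2 (hAB x)).symm.trans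
    (hBA _ _ (A.mem_graph x)).symm⟩

omit [CompleteSpace H] in
theorem isBoundedInverseOf_of_starProjection_eq {A : H →ₗ.[ℂ] H} {B : H →L[ℂ] H}
    {R : Submodule ℂ H} [R.HasOrthogonalProjection] (hP : ∀ x, R.starProjection x = x)
    (hAB : ∀ x, (B x, R.starProjection x) ∈ A.graph)
    (hBA : ∀ x y, (x, y) ∈ A.graph → B y = R.starProjection x) : IsBoundedInverseOf A B := by
  refine ⟨fun x => (hBA _ _ (A.mem_graph x)).trans (hP x), fun y => ?_⟩
  have hdom : B y ∈ A.domain := A.mem_domain_iff.2 ⟨_, hAB y⟩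
  exact ⟨hdom, ((A.image_iff hdom).2 (hAB y)).symm.trans (hP y)⟩

omit [CompleteSpace H] in
theorem IsSquareOf.mem_graph_iff {A A2 : H →ₗ.[ℂ] H} (h : IsSquareOf A A2) {x z : H} :
    (x, z) ∈ A2.graph ↔ ∃ y, (x, y) ∈ A.graph ∧ (y, z) ∈ A.graph := by
  constructor
  · intro hxz
    obtain ⟨u, hu, hz⟩ := A2.mem_graph_iff.1 hxz
    simp only at hu hz
    obtain ⟨h1, h2, h3⟩ := h.1 u
    rw [← hu, ← hz, h3]
    exact ⟨_, A.mem_graph ⟨u, h1⟩, A.mem_graph ⟨_, h2⟩⟩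
  · rintro ⟨y, hxy, hyz⟩
    have hx : x ∈ A.domain := A.mem_domain_iff.2 ⟨_, hxy⟩
    have hy : y ∈ A.domain := A.mem_domain_iff.2 ⟨_, hyz⟩
    obtain rfl : y = A ⟨x, hx⟩ := (A.image_iff hx).2 hxy
    have hx2 : x ∈ A2.domain := (h.2 x).2 ⟨hx, hy⟩
    obtain ⟨h1, h2, h3⟩ := h.1 ⟨x, hx2⟩
    rw [(A.image_iff hy).2 hyz, ← h3]
    exact A2.mem_graph ⟨x, hx2⟩

omit [CompleteSpace H] in
theorem mem_graph_addB {A : H →ₗ.[ℂ] H} {S : H →L[ℂ] H} {x y : H} :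
    (x, y) ∈ (addB A S).graph ↔ ∃ z, (x, z) ∈ A.graph ∧ y = z + S x := by
  constructor
  · intro h
    obtain ⟨u, hu, hy⟩ := (addB A S).mem_graph_iff.1 h
    simp only at hu hy
    rw [← hu, ← hy]
    exact ⟨_, A.mem_graph u, rfl⟩
  · rintro ⟨z, hz, rfl⟩
    obtain ⟨u, hu, hy⟩ := A.mem_graph_iff.1 hz
    simp only at hu hy
    rw [← hu, ← hy]
    exact (addB A S).mem_graph u

omit [CompleteSpace H] in
/-- If `T` is accretive with closed range and its square is m-accretive, the kernel of `T` is the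
orthogonal complement of its range. -/
theorem pKer_eq_orthogonal_pRange_of_isSquareOf {T T2 : H →ₗ.[ℂ] H} (hT : PAccretive T)
    (hsq : IsSquareOf T T2) (h2 : MAccretive T2) :
    pKer T2 = pKer T ∧ pKer T = (pRange T)ᗮ := by
  have hK : pKer T2 = pKer T := by
    apply le_antisymm
    · intro x hx
      obtain ⟨y, hxy, hy⟩ := hsq.mem_graph_iff.1 (mem_pKer_iff.1 hx)
      have h0 : ⟪y, y⟫ = 0 := (Submodule.mem_orthogonal _ _).1
        (hT.pKer_le_orthogonal_pRange (mem_pKer_iff.2 hy)) _ (mem_pRange_iff.2 ⟨x, hxy⟩)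
      rw [inner_self_eq_zero.1 h0] at hxy
      exact mem_pKer_iff.2 hxy
    · exact fun x hx => mem_pKer_iff.2
        (hsq.mem_graph_iff.2 ⟨0, mem_pKer_iff.1 hx, T.graph.zero_mem⟩)
  refine ⟨hK, le_antisymm hT.pKer_le_orthogonal_pRange ?_⟩
  rw [← hK, h2.pKer_eq_orthogonal_pRange]
  refine Submodule.orthogonal_le fun z hz => ?_
  obtain ⟨x, hx⟩ := mem_pRange_iff.1 hz
  obtain ⟨y, -, hy⟩ := hsq.mem_graph_iff.1 hx
  exact mem_pRange_iff.2 ⟨y, hy⟩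

omit [CompleteSpace H] in
theorem pKer_clmToPMap (S : H →L[ℂ] H) : pKer (clmToPMap S) = LinearMap.ker S.toLinearMap := by
  ext x
  constructor
  · rintro ⟨u, hu, rfl⟩
    exact hu
  · exact fun hx => ⟨⟨x, trivial⟩, hx, rfl⟩

omit [CompleteSpace H] in
theorem pRange_clmToPMap (S : H →L[ℂ] H) :
    pRange (clmToPMap S) = LinearMap.range S.toLinearMap := by
  ext x
  constructor
  · rintro ⟨u, rfl⟩
    exact ⟨u, rfl⟩
  · rintro ⟨u, rfl⟩
    exact ⟨⟨u, trivial⟩, rfl⟩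

omit [CompleteSpace H] in
theorem CAccretive.pAccretive {S : H →L[ℂ] H} (hS : CAccretive S) : PAccretive (clmToPMap S) :=
  fun x => hS x

omit [CompleteSpace H] in
theorem CAccretive.ker_le_orthogonal_range {S : H →L[ℂ] H} (hS : CAccretive S) :
    LinearMap.ker S.toLinearMap ≤ (LinearMap.range S.toLinearMap)ᗮ := by
  simpa only [pKer_clmToPMap, pRange_clmToPMap] using hS.pAccretive.pKer_le_orthogonal_pRange

theorem CAccretive.adjoint {S : H →L[ℂ] H} (hS : CAccretive S) :
    CAccretive (ContinuousLinearMap.adjoint S) := fun x => by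
  rw [ContinuousLinearMap.adjoint_inner_right, ← inner_conj_symm, Complex.conj_re]
  exact hS x

theorem CAccretive.ker_eq_orthogonal_range {S : H →L[ℂ] H} (hS : CAccretive S) :
    LinearMap.ker S.toLinearMap = (LinearMap.range S.toLinearMap)ᗮ := by
  refine le_antisymm hS.ker_le_orthogonal_range ?_
  rw [ContinuousLinearMap.orthogonal_range]
  refine hS.adjoint.ker_le_orthogonal_range.trans ?_
  rw [ContinuousLinearMap.orthogonal_range, ContinuousLinearMap.adjoint_adjoint]

theorem isUnit_one_add_mul_swap {A : Type*} [Ring A] {a b : A} (h : IsUnit (1 + a * b)) :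
    IsUnit (1 + b * a) := by
  obtain ⟨⟨u, v, huv, hvu⟩, rfl : u = 1 + a * b⟩ := h
  refine ⟨⟨1 + b * a, 1 - b * v * a, ?_, ?_⟩, rfl⟩
  · calc (1 + b * a) * (1 - b * v * a) = 1 + b * a - b * ((1 + a * b) * v) * a := by noncomm_ring
      _ = 1 := by rw [huv]; noncomm_ring
  · calc (1 - b * v * a) * (1 + b * a) = 1 + b * a - b * (v * (1 + a * b)) * a := by noncomm_ring
      _ = 1 := by rw [hvu]; noncomm_ring

theorem ring_inverse_one_add_mul_mul {A : Type*} [Ring A] {a b : A} (h : IsUnit (1 + a * b)) :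
    Ring.inverse (1 + a * b) * a = a * Ring.inverse (1 + b * a) := by
  have h' := isUnit_one_add_mul_swap h
  calc Ring.inverse (1 + a * b) * a
      = Ring.inverse (1 + a * b) * (a * (1 + b * a)) * Ring.inverse (1 + b * a) := by
        rw [mul_assoc, mul_assoc, Ring.mul_inverse_cancel _ h', mul_one]
    _ = Ring.inverse (1 + a * b) * (1 + a * b) * a * Ring.inverse (1 + b * a) := by noncomm_ring
    _ = a * Ring.inverse (1 + b * a) := by rw [Ring.inverse_mul_cancel _ h, one_mul]

omit [CompleteSpace H] in
/-- Bounded perturbation of an operator whose kernel is the orthogonal complement of its range: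
if the perturbation leaves the range invariant and vanishes on the kernel, then range and kernel
do not change, and the generalized inverse is given by a resolvent-type formula. -/
theorem addB_range_ker_inverse {A : H →ₗ.[ℂ] H} {G S : H →L[ℂ] H}
    {R : Submodule ℂ H} [R.HasOrthogonalProjection] (hR : pRange A = R) (hK : pKer A = Rᗮ)
    (hAG : ∀ x, (G x, R.starProjection x) ∈ A.graph)
    (hGA : ∀ x y, (x, y) ∈ A.graph → G y = R.starProjection x)
    (hG : ∀ x, R.starProjection (G x) = G x)
    (hPS : ∀ x, R.starProjection (S x) = S x) (hSP : ∀ x, S (R.starProjection x) = S x)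
    (hu : IsUnit (1 + G * S)) :
    pRange (addB A S) = R ∧ pKer (addB A S) = Rᗮ ∧
    (∀ x, ((Ring.inverse (1 + G * S) * G) x, R.starProjection x) ∈ (addB A S).graph) ∧
    (∀ x y, (x, y) ∈ (addB A S).graph →
      (Ring.inverse (1 + G * S) * G) y = R.starProjection x) ∧
    ∀ x, R.starProjection ((Ring.inverse (1 + G * S) * G) x) =
      (Ring.inverse (1 + G * S) * G) x := by
  have hAB : ∀ x, ((Ring.inverse (1 + G * S) * G) x, R.starProjection x) ∈
      (addB A S).graph := by
    intro x
    rw [ring_inverse_one_add_mul_mul hu]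
    have hw := DFunLike.congr_fun (Ring.mul_inverse_cancel _ (isUnit_one_add_mul_swap hu)) x
    simp only [mul_apply_eq_comp, add_apply,
      one_apply_eq_self] at hw ⊢
    refine mem_graph_addB.2 ⟨_, hAG _, ?_⟩
    conv_lhs => rw [← hw, map_add, hPS]
  have hBA : ∀ x y, (x, y) ∈ (addB A S).graph →
      (Ring.inverse (1 + G * S) * G) y = R.starProjection x := by
    intro x y hxy
    obtain ⟨z, hz, rfl⟩ := mem_graph_addB.1 hxy
    have hw := DFunLike.congr_fun (Ring.inverse_mul_cancel _ hu) (R.starProjection x)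
    simp only [mul_apply_eq_comp, add_apply,
      one_apply_eq_self, hSP] at hw ⊢
    rw [map_add, hGA x z hz, hw]
  refine ⟨le_antisymm ?_ ?_, le_antisymm ?_ ?_, hAB, hBA, fun x => ?_⟩
  · intro y hy
    obtain ⟨x, hx⟩ := mem_pRange_iff.1 hy
    obtain ⟨z, hz, rfl⟩ := mem_graph_addB.1 hx
    exact R.add_mem (hR ▸ mem_pRange_iff.2 ⟨x, hz⟩)
      (Submodule.starProjection_eq_self_iff.1 (hPS x))
  · intro y hy
    have := hAB y
    rw [Submodule.starProjection_eq_self_iff.2 hy] at this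
    exact mem_pRange_iff.2 ⟨_, this⟩
  · intro x hx
    have := hBA x 0 (mem_pKer_iff.1 hx)
    rw [map_zero] at this
    exact (R.starProjection_apply_eq_zero_iff).1 this.symm
  · intro x hx
    refine mem_pKer_iff.2 (mem_graph_addB.2 ⟨0, mem_pKer_iff.1 (hK ▸ hx), ?_⟩)
    rw [← hSP x, (R.starProjection_apply_eq_zero_iff).2 hx, map_zero, add_zero]
  · rw [ring_inverse_one_add_mul_mul hu]
    exact hG _

omit [CompleteSpace H] in
/-- The square of an operator whose kernel is the orthogonal complement of its range has the same
range. -/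
theorem IsSquareOf.pRange_eq {T T2 : H →ₗ.[ℂ] H} (hsq : IsSquareOf T T2)
    [(pRange T).HasOrthogonalProjection] (hK : pKer T = (pRange T)ᗮ) :
    pRange T2 = pRange T := by
  apply le_antisymm
  · intro z hz
    obtain ⟨x, hx⟩ := mem_pRange_iff.1 hz
    obtain ⟨y, -, hy⟩ := hsq.mem_graph_iff.1 hx
    exact mem_pRange_iff.2 ⟨y, hy⟩
  · intro y hy
    obtain ⟨x, hx⟩ := mem_pRange_iff.1 hy
    have hker := mem_pKer_iff.1 (hK ▸ (pRange T).sub_starProjection_mem_orthogonal x)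
    have hx' := T.graph.sub_mem hx hker
    rw [Prod.mk_sub_mk, sub_sub_cancel, sub_zero] at hx'
    obtain ⟨w, hw⟩ := mem_pRange_iff.1 ((pRange T).starProjection_apply_mem x)
    exact mem_pRange_iff.2 ⟨w, hsq.mem_graph_iff.2 ⟨_, hw, hx'⟩⟩

theorem stmt_16 (T T2 : H →ₗ.[ℂ] H) (S Td T2d : H →L[ℂ] H)
    (hT : PAccretive T) (hcl : IsClosed ((pRange T : Set H)))
    (hsq : IsSquareOf T T2) (h2 : MAccretive T2) (hS : CAccretive S)
    (hTd : IsMoorePenroseInverse T (clmToPMap Td))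
    (hT2d : IsMoorePenroseInverse T2 (clmToPMap T2d))
    (halt : (LinearMap.range S.toLinearMap ≤ pRange T ∧ ‖Td * Td * S‖ < 1) ∨
            (pKer T ≤ LinearMap.ker S.toLinearMap ∧ ‖S * T2d‖ < 1)) :
    pRange (addB T2 S) = pRange T2 ∧ pRange T2 = pRange T ∧
    IsClosed ((pRange (addB T2 S) : Set H)) ∧
    pKer (addB T2 S) = pKer T2 ∧ pKer T2 = pKer T ∧
    IsCompl (pRange (addB T2 S)) (pKer (addB T2 S)) ∧
    IsEPPMap (addB T2 S) ∧
    IsMoorePenroseInverse (addB T2 S)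
      (clmToPMap (Ring.inverse (1 + Td * Td * S) * (Td * Td))) ∧
    Ring.inverse (1 + Td * Td * S) * (Td * Td) = Td * Td * Ring.inverse (1 + S * (Td * Td)) ∧
    ((∀ x : T.domain, T x = 0 → (x : H) = 0) →
      (∃ B : H →L[ℂ] H, IsBoundedInverseOf T B) ∧
      (∃ B : H →L[ℂ] H, IsBoundedInverseOf T2 B) ∧
      IsBoundedInverseOf (addB T2 S) (Ring.inverse (1 + Td * Td * S) * (Td * Td))) := by
  have : CompleteSpace (pRange T) := hcl.completeSpace_coe
  obtain ⟨hK2, hK⟩ := pKer_eq_orthogonal_pRange_of_isSquareOf hT hsq h2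
  have hR2 := hsq.pRange_eq hK
  have hK2' := hK2.trans hK
  have hTG := hTd.apply_mem_graph rfl
  have hGT : ∀ x y, (x, y) ∈ T.graph → Td y = (pRange T).starProjection x :=
    fun x y h => hTd.apply_of_mem_graph hK h
  have hG := hTd.starProjection_apply hK
  have hGP : ∀ x, Td ((pRange T).starProjection x) = Td x := fun x =>
    (hGT _ _ (hTG x)).trans (hG x)
  have hTG2 : ∀ x, ((Td * Td) x, (pRange T).starProjection x) ∈ T2.graph := fun x =>
    hsq.mem_graph_iff.2 ⟨Td x, by simpa only [hG, mul_apply_eq_comp] using hTG (Td x), hTG x⟩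
  have hGT2 : ∀ x y, (x, y) ∈ T2.graph → (Td * Td) y = (pRange T).starProjection x := by
    intro x z h
    obtain ⟨y, hxy, hyz⟩ := hsq.mem_graph_iff.1 h
    rw [mul_apply_eq_comp, hGT y z hyz, hGP, hGT x y hxy]
  have hG2 : ∀ x, (pRange T).starProjection ((Td * Td) x) = (Td * Td) x := fun x => hG _
  have hT2d_eq : T2d = Td * Td := by
    ext x
    rw [← hT2d.starProjection_apply hK2' x, ← hGT2 _ _ (hT2d.apply_mem_graph hR2 x),
      mul_apply_eq_comp, hGP]
    rfl
  have hSKR : pKer T ≤ LinearMap.ker S.toLinearMap ∧ LinearMap.range S.toLinearMap ≤ pRange T := by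
    rcases halt with ⟨h, -⟩ | ⟨h, -⟩
    · refine ⟨?_, h⟩
      rw [hK, hS.ker_eq_orthogonal_range]
      exact Submodule.orthogonal_le h
    · refine ⟨h, ?_⟩
      rw [← (pRange T).orthogonal_orthogonal, ← hK]
      exact (Submodule.le_orthogonal_orthogonal _).trans
        (Submodule.orthogonal_le (h.trans hS.ker_le_orthogonal_range))
  have hPS : ∀ x, (pRange T).starProjection (S x) = S x := fun x =>
    Submodule.starProjection_eq_self_iff.2 (hSKR.2 ⟨x, rfl⟩)
  have hSP : ∀ x, S ((pRange T).starProjection x) = S x := by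
    intro x
    have h : S (x - (pRange T).starProjection x) = 0 :=
      hSKR.1 (hK ▸ (pRange T).sub_starProjection_mem_orthogonal x)
    rw [map_sub] at h
    exact (sub_eq_zero.1 h).symm
  have hu : IsUnit (1 + Td * Td * S) := by
    rcases halt with ⟨-, h⟩ | ⟨-, h⟩
    · rw [← norm_neg] at h
      simpa using isUnit_one_sub_of_norm_lt_one h
    · rw [hT2d_eq, ← norm_neg] at h
      exact isUnit_one_add_mul_swap (by simpa using isUnit_one_sub_of_norm_lt_one h)
  obtain ⟨hRA, hKA, hAB, hBA, hB⟩ :=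
    addB_range_ker_inverse hR2 hK2' hTG2 hGT2 hG2 hPS hSP hu
  have hMP := isMoorePenroseInverse_clmToPMap hRA hKA hAB hBA hB
  refine ⟨hRA.trans hR2.symm, hR2, hRA ▸ hcl, hKA.trans hK2'.symm, hK2, ?_,
    isEPPMap_of_apply hMP hAB hBA, hMP, ring_inverse_one_add_mul_mul hu, fun hinj => ?_⟩
  · rw [hRA, hKA]
    exact (pRange T).isCompl_orthogonal
  · have hP : ∀ x, (pRange T).starProjection x = x := by
      intro x
      have hx : x - (pRange T).starProjection x ∈ pKer T :=
        hK ▸ (pRange T).sub_starProjection_mem_orthogonal x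
      obtain ⟨u, hu, hux⟩ := hx
      rw [← sub_eq_zero, ← neg_sub, ← hux, neg_eq_zero]
      exact hinj u hu
    exact ⟨⟨Td, isBoundedInverseOf_of_starProjection_eq hP hTG hGT⟩,
      ⟨Td * Td, isBoundedInverseOf_of_starProjection_eq hP hTG2 hGT2⟩,
      isBoundedInverseOf_of_starProjection_eq hP hAB hBA⟩
end
end

section
/- Let T be accretive with T² m-accretive on a complex Hilbert space H, let S be a bounded accretive operator, and set Υ = T² + S (which is m-accretive) with m-(π/4)-accretive square root Υ^{1/2}. Define Z₁ = T + Υ^{1/2} and Z₂ = T − Υ^{1/2} on D(T) ∩ D(Υ^{1/2}). Assume T(D(T²)) ⊆ D(T²) and Υ^{1/2}(D(T²)) ⊆ D(T²). Then for every λ ∈ ℂ and every x ∈ D(T²), λ²x − 2λTx − Sx = ½(λI − Z₁)(λI − Z₂)x + ½(λI − Z₂)(λI − Z₁)x. If in addition TS = ST on D(T²), then λ²x − 2λTx − Sx = (λI − Z₁)(λI − Z₂)x = (λI − Z₂)(λI − Z₁)x for all x ∈ D(T²). -/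
open scoped ComplexInnerProductSpace
noncomputable section

variable {H : Type*} [NormedAddCommGroup H] [InnerProductSpace ℂ H] [CompleteSpace H]

open Filter Topology

omit [CompleteSpace H] in
/-- A partially defined operator whose domain is everything is given by a linear map. -/
theorem LinearPMap.exists_eq_toPMap_top (A : H →ₗ.[ℂ] H) (h : ∀ x, x ∈ A.domain) :
    ∃ a : H →ₗ[ℂ] H, A = a.toPMap ⊤ := by
  refine ⟨A.toFun.comp (LinearMap.id.codRestrict A.domain h), ?_⟩
  refine LinearPMap.ext ?_ ?_
  · ext x; simp [h x]
  · intro x hx hx'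
    rfl

/-- An everywhere defined accretive operator on a Hilbert space is continuous. -/
theorem LinearMap.continuous_of_accretive (a : H →ₗ[ℂ] H)
    (ha : ∀ x, 0 ≤ (⟪x, a x⟫).re) : Continuous a := by
  refine LinearMap.continuous_of_seq_closed_graph a fun u x y hu hy => ?_
  have key : ∀ v : H, 0 ≤ (⟪x - v, y - a v⟫).re := by
    intro v
    have h1 : Tendsto (fun n => (⟪u n - v, a (u n) - a v⟫).re) atTop
        (𝓝 (⟪x - v, y - a v⟫).re) :=
      (Complex.continuous_re.tendsto _).comp
        ((hu.sub_const v).inner (hy.sub_const (a v)))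
    refine ge_of_tendsto' h1 fun n => ?_
    rw [← map_sub]; exact ha _
  have key2 : ∀ (w : H), 0 ≤ (⟪w, y - a x⟫).re := by
    intro w
    have h1 : Tendsto (fun t : ℝ => (⟪w, y - a x⟫).re + t * (⟪w, a w⟫).re) (𝓝[>] 0)
        (𝓝 ((⟪w, y - a x⟫).re + 0 * (⟪w, a w⟫).re)) := by
      refine Tendsto.mono_left ?_ nhdsWithin_le_nhds
      exact Continuous.tendsto (by fun_prop) 0
    rw [zero_mul, add_zero] at h1
    refine ge_of_tendsto h1 ?_
    filter_upwards [self_mem_nhdsWithin] with t ht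
    have ht' : (0 : ℝ) < t := ht
    have h2 := key (x - (t : ℂ) • w)
    have h3 : ⟪x - (x - (t : ℂ) • w), y - a (x - (t : ℂ) • w)⟫
        = (t : ℂ) * (⟪w, y - a x⟫ + t * ⟪w, a w⟫) := by
      have : y - a (x - (t : ℂ) • w) = (y - a x) + (t : ℂ) • a w := by
        rw [map_sub, map_smul]; abel
      rw [this, sub_sub_cancel, inner_smul_left, inner_add_right, inner_smul_right,
        Complex.conj_ofReal]
    rw [h3, Complex.re_ofReal_mul, Complex.add_re, Complex.re_ofReal_mul] at h2
    exact nonneg_of_mul_nonneg_right h2 ht'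
  have h4 := key2 (-(y - a x))
  rw [inner_neg_left, Complex.neg_re] at h4
  have h5 : (⟪y - a x, y - a x⟫).re = ‖y - a x‖ ^ 2 := by
    rw [inner_self_eq_norm_sq_to_K]; norm_cast
  have h6 : ‖y - a x‖ = 0 := by
    have := sq_nonneg ‖y - a x‖
    exact pow_eq_zero_iff two_ne_zero |>.1 (by linarith)
  exact sub_eq_zero.1 (norm_eq_zero.1 h6)

omit [CompleteSpace H] in
/-- A bounded operator whose numerical range lies in the sector `|Im z| ≤ Re z` dominates
the square of its norm by the real part of its quadratic form. -/
theorem exists_norm_sq_le_re_inner (R : H →L[ℂ] H)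
    (hR : ∀ x, |(⟪x, R x⟫).im| ≤ (⟪x, R x⟫).re) :
    ∃ m : ℝ, 0 < m ∧ ∀ x, m * ‖R x‖ ^ 2 ≤ (⟪x, R x⟫).re := by
  obtain ⟨t, ht, htR⟩ : ∃ t : ℝ, 0 < t ∧ t * ‖R‖ ≤ 1 / 2 := by
    refine ⟨1 / (2 * (‖R‖ + 1)), by positivity, ?_⟩
    rw [div_mul_eq_mul_div, div_le_iff₀ (by positivity)]
    linarith
  refine ⟨t / 2, by positivity, fun x => ?_⟩
  have expand : ∀ s : ℂ, ⟪x + s • R x, R (x + s • R x)⟫ = ⟪x, R x⟫ + s * ⟪x, R (R x)⟫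
      + (starRingEnd ℂ) s * (‖R x‖ ^ 2 : ℝ) + s * (starRingEnd ℂ) s * ⟪R x, R (R x)⟫ := by
    intro s
    have : ⟪R x, R x⟫ = ((‖R x‖ ^ 2 : ℝ) : ℂ) := by
      rw [inner_self_eq_norm_sq_to_K]; norm_cast
    rw [map_add, map_smul, inner_add_left, inner_add_right, inner_add_right, inner_smul_left,
      inner_smul_left, inner_smul_right, inner_smul_right, this]
    ring
  have hN := sq_nonneg ‖R x‖
  have h1 := abs_le.1 (hR (x + (-t : ℂ) • R x))
  have h2 := abs_le.1 (hR (x + (t * Complex.I : ℂ) • R x))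
  have h3 := abs_le.1 (hR (x + (-t * Complex.I : ℂ) • R x))
  rw [expand] at h1 h2 h3
  have hb : (⟪R x, R (R x)⟫).re ≤ ‖R‖ * ‖R x‖ ^ 2 := by
    calc (⟪R x, R (R x)⟫).re ≤ ‖⟪R x, R (R x)⟫‖ := Complex.re_le_norm _
      _ ≤ ‖R x‖ * ‖R (R x)‖ := norm_inner_le_norm _ _
      _ ≤ ‖R x‖ * (‖R‖ * ‖R x‖) := by gcongr; exact R.le_opNorm _
      _ = ‖R‖ * ‖R x‖ ^ 2 := by ring
  generalize ⟪R x, R (R x)⟫ = d at *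
  generalize ⟪x, R (R x)⟫ = c at *
  generalize ⟪x, R x⟫ = b at *
  generalize ‖R x‖ ^ 2 = N at *
  simp only [map_neg, map_mul, Complex.conj_ofReal, Complex.conj_I, Complex.add_re,
    Complex.add_im, Complex.mul_re, Complex.mul_im, Complex.neg_re, Complex.neg_im,
    Complex.ofReal_re, Complex.ofReal_im, Complex.I_re, Complex.I_im] at h1 h2 h3
  have h4 : t * N ≤ b.re + t ^ 2 * d.re := by
    linarith [h1.1, h1.2, h2.1, h2.2, h3.1, h3.2]
  have h5 : t ^ 2 * d.re ≤ t / 2 * N := by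
    calc t ^ 2 * d.re ≤ t ^ 2 * (‖R‖ * N) := by gcongr
      _ = t * N * (t * ‖R‖) := by ring
      _ ≤ t * N * (1 / 2) := by gcongr
      _ = t / 2 * N := by ring
  linarith

omit [CompleteSpace H] in
/-- For a bounded operator `R` and `m > 0` with `m ‖R x‖² ≤ Re ⟨R x, x⟩`, the iterates of the
contraction `1 - m R` are asymptotically annihilated by `R`. -/
theorem tendsto_apply_iterate_sub_smul (R : H →L[ℂ] H) {m : ℝ} (hm : 0 < m)
    (hR : ∀ x, m * ‖R x‖ ^ 2 ≤ (⟪x, R x⟫).re) (x : H) :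
    Tendsto (fun n : ℕ => R ((fun y => y - (m : ℂ) • R y)^[n] x)) atTop (𝓝 0) := by
  set L : H → H := fun y => y - (m : ℂ) • R y with hL
  have hdec : ∀ y, m ^ 2 * ‖R y‖ ^ 2 ≤ ‖y‖ ^ 2 - ‖L y‖ ^ 2 := by
    intro y
    have h1 : ‖L y‖ ^ 2 = ‖y‖ ^ 2 - 2 * (m * (⟪y, R y⟫).re) + (m * ‖R y‖) ^ 2 := by
      rw [hL, norm_sub_sq (𝕜 := ℂ), inner_smul_right, norm_smul, Complex.norm_real,
        Real.norm_of_nonneg hm.le]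
      simp
    have h2 := mul_le_mul_of_nonneg_left (hR y) hm.le
    rw [h1]
    nlinarith
  have hanti : Antitone fun n : ℕ => ‖L^[n] x‖ ^ 2 := by
    refine antitone_nat_of_succ_le fun n => ?_
    have := hdec (L^[n] x)
    rw [Function.iterate_succ_apply']
    nlinarith [mul_nonneg (sq_nonneg m) (sq_nonneg ‖R (L^[n] x)‖)]
  have hlim := tendsto_atTop_ciInf hanti ⟨0, by rintro _ ⟨n, rfl⟩; positivity⟩
  have hdiff := hlim.sub (hlim.comp (tendsto_add_atTop_nat 1))
  rw [sub_self] at hdiff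
  have hsq : Tendsto (fun n : ℕ => m ^ 2 * ‖R (L^[n] x)‖ ^ 2) atTop (𝓝 0) := by
    refine squeeze_zero (fun n => by positivity) (fun n => ?_) hdiff
    simpa only [Function.comp_apply, Function.iterate_succ_apply'] using hdec (L^[n] x)
  have h3 := (hsq.const_mul (m ^ 2)⁻¹).sqrt
  rw [mul_zero, Real.sqrt_zero] at h3
  rw [tendsto_zero_iff_norm_tendsto_zero]
  refine h3.congr fun n => ?_
  rw [inv_mul_cancel_left₀ (by positivity), Real.sqrt_sq (norm_nonneg _)]

/-- A bounded operator commuting with the square of a bounded operator `R` whose numerical range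
lies in the sector `|Im z| ≤ Re z` commutes with `R`. -/
theorem commute_of_commute_sq (T R : H →L[ℂ] H)
    (hR : ∀ x, |(⟪x, R x⟫).im| ≤ (⟪x, R x⟫).re)
    (hTR : ∀ x, T (R (R x)) = R (R (T x))) (x : H) : T (R x) = R (T x) := by
  obtain ⟨m, hm, hmR⟩ := exists_norm_sq_le_re_inner R hR
  set C : H →L[ℂ] H := T.comp R - R.comp T with hC
  have hCx : ∀ y, C y = T (R y) - R (T y) := fun y => rfl
  have hanti : ∀ y, R (C y) = -C (R y) := by
    intro y
    rw [hCx, hCx, map_sub, hTR]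
    abel
  set L : H → H := fun y => y - (m : ℂ) • R y with hL
  set P : H → H := fun y => y + (m : ℂ) • R y with hP
  have hRL : Function.Commute R L := fun y => by simp only [hL, map_sub, map_smul]
  have hCL : Function.Semiconj C L P := fun y => by
    simp only [hL, hP, map_sub, map_smul, hanti, smul_neg]
    exact sub_eq_add_neg _ _
  have hPn : ∀ y, ‖y‖ ≤ ‖P y‖ := by
    intro y
    refine (sq_le_sq₀ (norm_nonneg _) (norm_nonneg _)).1 ?_
    have h1 : 0 ≤ (⟪y, R y⟫).re := (abs_nonneg _).trans (hR y)
    rw [hP, norm_add_sq (𝕜 := ℂ), inner_smul_right]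
    simp only [RCLike.re_eq_complex_re, Complex.re_ofReal_mul]
    nlinarith [mul_nonneg hm.le h1, sq_nonneg ‖(m : ℂ) • R y‖]
  have hPiter : ∀ (n : ℕ) y, ‖y‖ ≤ ‖P^[n] y‖ := by
    intro n y
    induction n with
    | zero => rfl
    | succ k ih => rw [Function.iterate_succ_apply']; exact ih.trans (hPn _)
  have hCR : ∀ y, C (R y) = 0 := by
    intro y
    have h1 := ((C.continuous.tendsto _).comp (tendsto_apply_iterate_sub_smul R hm hmR y)).norm
    rw [map_zero, norm_zero] at h1
    refine norm_le_zero_iff.1 (ge_of_tendsto' h1 fun n => ?_)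
    have h2 := hCL.iterate_right n (R y)
    rw [Function.comp_apply, (hRL.iterate_right n) y, h2]
    exact hPiter n _
  have hker2 : ∀ y, R (R y) = 0 → R y = 0 := by
    intro y hy
    have h1 := tendsto_apply_iterate_sub_smul R hm hmR y
    have h2 : ∀ n : ℕ, R (L^[n] y) = R y := by
      intro n
      rw [(hRL.iterate_right n) y]
      exact Function.iterate_fixed (by simp [hL, hy]) n
    exact tendsto_nhds_unique (tendsto_const_nhds.congr fun n => (h2 n).symm) h1
  have hker : ∀ y, R y = 0 → C y = 0 := by
    intro y hy
    have h1 := hTR y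
    rw [hy, map_zero, map_zero] at h1
    rw [hCx, hy, map_zero, hker2 _ h1.symm, sub_zero]
  let V : Submodule ℂ H := R.range.topologicalClosure
  have hV : V ≤ C.ker := by
    refine Submodule.topologicalClosure_minimal _ ?_ C.isClosed_ker
    rintro _ ⟨y, rfl⟩
    exact hCR y
  have hVo : Vᗮ ≤ C.ker := by
    intro w hw
    rw [Submodule.orthogonal_closure] at hw
    have h1 : ⟪w, R w⟫ = 0 :=
      Submodule.inner_left_of_mem_orthogonal (LinearMap.mem_range_self R.toLinearMap w) hw
    have h2 := hmR w
    rw [h1, Complex.zero_re] at h2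
    have h3 : ‖R w‖ ^ 2 ≤ 0 := by nlinarith
    exact hker w (by simpa using h3.antisymm (sq_nonneg _))
  have : CompleteSpace V := (Submodule.isClosed_topologicalClosure _).completeSpace_coe
  have htop : (⊤ : Submodule ℂ H) ≤ C.ker := by
    rw [← Submodule.sup_orthogonal_of_hasOrthogonalProjection (K := V)]
    exact sup_le hV hVo
  exact sub_eq_zero.1 (htop (Submodule.mem_top (x := x)))

omit [CompleteSpace H] in
/-- A numerical range in the sector `|arg z| ≤ π / 4` satisfies `|Im z| ≤ Re z`. -/
theorem abs_im_inner_le_re_of_abs_arg_le (R : H → H)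
    (hRs : ∀ (c : ℝ) x, R ((c : ℂ) • x) = (c : ℂ) • R x)
    (h : ∀ x : H, ‖x‖ = 1 → |(⟪x, R x⟫).arg| ≤ Real.pi / 4) (x : H) :
    |(⟪x, R x⟫).im| ≤ (⟪x, R x⟫).re := by
  have unit : ∀ y : H, ‖y‖ = 1 → |(⟪y, R y⟫).im| ≤ (⟪y, R y⟫).re := by
    intro y hy
    have h1 := h y hy
    generalize ⟪y, R y⟫ = z at *
    have h2 := abs_le.1 h1
    have hc : Real.cos (Real.pi / 4) ≤ Real.cos z.arg := by
      rw [← Real.cos_abs z.arg]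
      exact Real.cos_le_cos_of_nonneg_of_le_pi (abs_nonneg _) (by linarith [Real.pi_pos]) h1
    have hs : |Real.sin z.arg| ≤ Real.sin (Real.pi / 4) := by
      refine abs_le.2 ⟨?_, ?_⟩
      · rw [← Real.sin_neg]
        exact Real.sin_le_sin_of_le_of_le_pi_div_two (by linarith [Real.pi_pos])
          (by linarith [Real.pi_pos]) h2.1
      · exact Real.sin_le_sin_of_le_of_le_pi_div_two (by linarith [Real.pi_pos])
          (by linarith [Real.pi_pos]) h2.2
    rw [← Complex.norm_mul_cos_arg z, ← Complex.norm_mul_sin_arg z, abs_mul, abs_norm]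
    refine mul_le_mul_of_nonneg_left (hs.trans (le_trans (le_of_eq ?_) hc)) (norm_nonneg _)
    rw [Real.sin_pi_div_four, Real.cos_pi_div_four]
  rcases eq_or_ne x 0 with rfl | hx
  · simp
  · have hx' : 0 < ‖x‖ := norm_pos_iff.2 hx
    have h1 := unit (((‖x‖⁻¹ : ℝ) : ℂ) • x) (by
      rw [norm_smul, Complex.norm_real, norm_inv, norm_norm, inv_mul_cancel₀ hx'.ne'])
    rw [hRs, inner_smul_left, inner_smul_right, Complex.conj_ofReal, Complex.re_ofReal_mul,
      Complex.re_ofReal_mul, Complex.im_ofReal_mul, Complex.im_ofReal_mul, abs_mul, abs_mul,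
      abs_of_pos (inv_pos.2 hx')] at h1
    have h2 := inv_pos.2 hx'
    exact le_of_mul_le_mul_left (le_of_mul_le_mul_left h1 h2) h2

theorem stmt_17 (T T2 R : H →ₗ.[ℂ] H) (S : H →L[ℂ] H)
    (hT : PAccretive T) (hsq : IsSquareOf T T2) (h2 : MAccretive T2) (hS : CAccretive S)
    (hR : MAccretive R) (hRsec : SectorialP R (Real.pi / 4))
    (hRsq : IsSquareOf R (addB T2 S))
    (hTinv : ∀ (x : H) (_ : x ∈ T2.domain) (hT' : x ∈ T.domain), T ⟨x, hT'⟩ ∈ T2.domain)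
    (hRinv : ∀ (x : H) (_ : x ∈ T2.domain) (hR' : x ∈ R.domain), R ⟨x, hR'⟩ ∈ T2.domain) :
    (∀ (lam : ℂ) (x : H), x ∈ T2.domain →
      ∃ (hxT : x ∈ T.domain)
        (h2a : x ∈ (pSub T R).domain)
        (h1a : lam • x - (pSub T R) ⟨x, h2a⟩ ∈ (pAdd T R).domain)
        (h2b : x ∈ (pAdd T R).domain)
        (h1b : lam • x - (pAdd T R) ⟨x, h2b⟩ ∈ (pSub T R).domain),
        lam ^ 2 • x - (2 * lam) • T ⟨x, hxT⟩ - S x =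
          (2 : ℂ)⁻¹ • (lam • (lam • x - (pSub T R) ⟨x, h2a⟩) -
              (pAdd T R) ⟨lam • x - (pSub T R) ⟨x, h2a⟩, h1a⟩) +
          (2 : ℂ)⁻¹ • (lam • (lam • x - (pAdd T R) ⟨x, h2b⟩) -
              (pSub T R) ⟨lam • x - (pAdd T R) ⟨x, h2b⟩, h1b⟩)) ∧
    ((∀ (x : H), x ∈ T2.domain → ∃ (hT' : x ∈ T.domain) (hST : S x ∈ T.domain),
        T ⟨S x, hST⟩ = S (T ⟨x, hT'⟩)) →
      ∀ (lam : ℂ) (x : H), x ∈ T2.domain →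
        ∃ (hxT : x ∈ T.domain)
          (h2a : x ∈ (pSub T R).domain)
          (h1a : lam • x - (pSub T R) ⟨x, h2a⟩ ∈ (pAdd T R).domain)
          (h2b : x ∈ (pAdd T R).domain)
          (h1b : lam • x - (pAdd T R) ⟨x, h2b⟩ ∈ (pSub T R).domain),
          lam ^ 2 • x - (2 * lam) • T ⟨x, hxT⟩ - S x =
            lam • (lam • x - (pSub T R) ⟨x, h2a⟩) -
              (pAdd T R) ⟨lam • x - (pSub T R) ⟨x, h2a⟩, h1a⟩ ∧
          lam ^ 2 • x - (2 * lam) • T ⟨x, hxT⟩ - S x =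
            lam • (lam • x - (pAdd T R) ⟨x, h2b⟩) -
              (pSub T R) ⟨lam • x - (pAdd T R) ⟨x, h2b⟩, h1b⟩) := by
  have hD : ∀ x, x ∈ T2.domain := by
    intro y
    obtain ⟨x, hx⟩ := h2.2.2.2 1 one_pos y
    obtain ⟨hx1, hx2, hx3⟩ := hsq.1 x
    rw [← hx, hx3]
    exact add_mem (T2.domain.smul_mem _ x.2) (hTinv _ (hTinv _ x.2 hx1) hx2)
  have hDT : ∀ x, x ∈ T.domain := fun x => ((hsq.2 x).1 (hD x)).1
  have hDR : ∀ x, x ∈ R.domain := fun x => ((hRsq.2 x).1 (hD x)).1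
  obtain ⟨t, rfl⟩ := T.exists_eq_toPMap_top hDT
  obtain ⟨r, rfl⟩ := R.exists_eq_toPMap_top hDR
  have hT2 : ∀ x, T2 ⟨x, hD x⟩ = t (t x) := fun x => (hsq.1 ⟨x, hD x⟩).choose_spec.choose_spec
  have hr2 : ∀ x, r (r x) = t (t x) + S x := fun x => by
    rw [← hT2]
    exact ((hRsq.1 ⟨x, hD x⟩).choose_spec.choose_spec).symm
  have hadd : ∀ x h, pAdd (t.toPMap ⊤) (r.toPMap ⊤) ⟨x, h⟩ = t x + r x := fun _ _ => rfl
  have hsub : ∀ x h, pSub (t.toPMap ⊤) (r.toPMap ⊤) ⟨x, h⟩ = t x - r x := fun _ _ => rfl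
  have happ : ∀ x h, t.toPMap ⊤ ⟨x, h⟩ = t x := fun _ _ => rfl
  have mA : ∀ x, x ∈ (pAdd (t.toPMap ⊤) (r.toPMap ⊤)).domain := fun x => ⟨hDT x, hDR x⟩
  have mS : ∀ x, x ∈ (pSub (t.toPMap ⊤) (r.toPMap ⊤)).domain := fun x => ⟨hDT x, hDR x⟩
  refine ⟨fun lam x _ => ⟨hDT x, mS x, mA _, mA x, mS _, ?_⟩,
    fun hcomm lam x _ => ⟨hDT x, mS x, mA _, mA x, mS _, ?_⟩⟩
  · simp only [hadd, hsub, happ, map_add, map_sub, map_smul, hr2]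
    module
  · have hrc : Continuous r := LinearMap.continuous_of_accretive r fun x => hR.1 ⟨x, trivial⟩
    have htc : Continuous t := LinearMap.continuous_of_accretive t fun x => hT ⟨x, trivial⟩
    have hts : ∀ x, t (S x) = S (t x) := fun x => (hcomm x (hD x)).choose_spec.choose_spec
    have htr : t (r x) = r (t x) := by
      refine commute_of_commute_sq ⟨t, htc⟩ ⟨r, hrc⟩ ?_ (fun y => ?_) x
      · exact abs_im_inner_le_re_of_abs_arg_le r (fun c y => r.map_smul _ y)
          fun y hy => hRsec ⟨y, trivial⟩ hy
      · change t (r (r y)) = r (r (t y))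
        rw [hr2, hr2, map_add, hts]
    simp only [hadd, hsub, happ, map_add, map_sub, map_smul, hr2, htr]
    constructor <;> module
end
end
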